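/- (Pfaff-type recurrence for the q-binomial sum) Let q be a nonzero complex number, let n ≥ 1 be an integer with (q;q)_n ≠ 0, and let z be a complex number. Define S_n(z;q) := ∑_{j=0}^{n} ((q^{-n};q)_j/(q;q)_j) z^j. Then S_n(z;q) = (1 − z q^{-n}) · S_{n−1}(z;q). -/

import Mathlib

/-- The $q$-shifted factorial $(a;q)_m = \prod_{k=0}^{m-1}(1 - a q^k)$. -/
noncomputable def qPoch (q a : ℂ) (m : ℕ) : ℂ := ∏ k ∈ Finset.range m, (1 - a * q ^ k)

/-- The terminating $q$-binomial sum $S_n(z;q) = \sum_{j=0}^n \frac{(q^{-n};q)_j}{(q;q)_j} z^j$. -/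
noncomputable def Sqbin (q z : ℂ) (n : ℕ) : ℂ :=
  ∑ j ∈ Finset.range (n + 1), qPoch q (q ^ (-(n : ℤ))) j / qPoch q q j * z ^ j

@[simp]
lemma qPoch_zero (q a : ℂ) : qPoch q a 0 = 1 :=
  Finset.prod_range_zero _

lemma qPoch_succ (q a : ℂ) (m : ℕ) : qPoch q a (m + 1) = qPoch q a m * (1 - a * q ^ m) :=
  Finset.prod_range_succ _ _

lemma qPoch_succ' (q a : ℂ) (m : ℕ) : qPoch q a (m + 1) = (1 - a) * qPoch q (a * q) m := by
  unfold qPoch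
  rw [Finset.prod_range_succ', mul_comm]
  congr 1
  · simp
  · exact Finset.prod_congr rfl fun k _ => by ring

lemma qPoch_ne_zero_of_le {q a : ℂ} {m n : ℕ} (h : m ≤ n) (hn : qPoch q a n ≠ 0) :
    qPoch q a m ≠ 0 := by
  unfold qPoch at *
  rw [Finset.prod_ne_zero_iff] at *
  exact fun k hk => hn k (Finset.range_mono h hk)

lemma qPoch_neg_succ_eq_zero {q : ℂ} (hq : q ≠ 0) (m : ℕ) :
    qPoch q (q ^ (-(m : ℤ))) (m + 1) = 0 := by
  rw [qPoch_succ, zpow_neg, zpow_natCast, inv_mul_cancel₀ (pow_ne_zero m hq), sub_self, mul_zero]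

lemma qPoch_div_succ {q : ℂ} (a : ℂ) {j : ℕ} (h : qPoch q q (j + 1) ≠ 0) :
    qPoch q a (j + 1) / qPoch q q (j + 1) =
      qPoch q (a * q) (j + 1) / qPoch q q (j + 1) - a * (qPoch q (a * q) j / qPoch q q j) := by
  rw [qPoch_succ' q a, qPoch_succ q (a * q)]
  rw [qPoch_succ] at h ⊢
  rw [← mul_div_mul_right (qPoch q (a * q) j) _ (right_ne_zero_of_mul h), mul_div_assoc', ← sub_div]
  congr 1
  ring

/-- Pfaff-type recurrence for the $q$-binomial sum:
$S_n(z;q) = (1 - zq^{-n}) S_{n-1}(z;q)$. -/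
theorem qbin_recurrence (q z : ℂ) (hq : q ≠ 0) (n : ℕ) (hn : 1 ≤ n)
    (hqq : qPoch q q n ≠ 0) :
    Sqbin q z n = (1 - z * q ^ (-(n : ℤ))) * Sqbin q z (n - 1) := by
  obtain ⟨m, rfl⟩ : ∃ m, n = m + 1 := ⟨n - 1, by omega⟩
  have hshift : q ^ (-((m + 1 : ℕ) : ℤ)) * q = q ^ (-(m : ℤ)) := by
    rw [← zpow_add_one₀ hq]
    congr 1
    push_cast
    ring
  have hzero := qPoch_neg_succ_eq_zero hq m
  rw [Nat.add_sub_cancel]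
  unfold Sqbin
  rw [← hshift] at hzero ⊢
  set a := q ^ (-((m + 1 : ℕ) : ℤ))
  have hext : ∑ j ∈ Finset.range (m + 1), qPoch q (a * q) j / qPoch q q j * z ^ j =
      ∑ j ∈ Finset.range (m + 1),
        qPoch q (a * q) (j + 1) / qPoch q q (j + 1) * z ^ (j + 1) + 1 := by
    have h := Finset.sum_range_succ (fun j => qPoch q (a * q) j / qPoch q q j * z ^ j) (m + 1)
    rw [Finset.sum_range_succ'] at h
    simpa [hzero] using h.symm
  rw [sub_mul, one_mul]
  nth_rw 1 [hext]
  rw [Finset.sum_range_succ', Finset.mul_sum, add_sub_right_comm, ← Finset.sum_sub_distrib]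
  congr 1
  · refine Finset.sum_congr rfl fun j hj => ?_
    rw [qPoch_div_succ a (qPoch_ne_zero_of_le (Finset.mem_range.mp hj) hqq)]
    ring
  · simp
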